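/- Let L be a domain, let E be a topological space, let ν be an L-valued maxitive measure on the Borel σ-algebra ℬ of E, and let c⁺ : E → L be the map x ↦ ν⁺([x]). If ν is tight and outer-continuous, then c⁺ is upper compact. Conversely, if ν is weakly inner-continuous and c⁺ is upper compact, then ν is tight. -/

import Mathlib

open Set

universe u v

section OrderDefs
variable {L : Type u} [PartialOrder L]

/-- A filtered (nonempty, downward directed) subset of a poset. -/
def DirFiltered (F : Set L) : Prop :=
  F.Nonempty ∧ ∀ r ∈ F, ∀ s ∈ F, ∃ t ∈ F, t ≤ r ∧ t ≤ s

/-- A filter of a poset: a filtered upper set. -/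
def OrdFilter (F : Set L) : Prop :=
  DirFiltered F ∧ ∀ r ∈ F, ∀ s : L, r ≤ s → s ∈ F

/-- Every filter has an infimum. -/
def FilteredComplete (L : Type u) [PartialOrder L] : Prop :=
  ∀ F : Set L, OrdFilter F → ∃ i : L, IsGLB F i

/-- `s` is way-above `r`: for every filter `F` with an infimum below `r`, `s ∈ F`. -/
def WayAbove (s r : L) : Prop :=
  ∀ F : Set L, OrdFilter F → ∀ i : L, IsGLB F i → i ≤ r → s ∈ F

/-- The poset is continuous: for every `r`, the set of elements way-above `r`
is a filter whose infimum is `r`. -/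
def ContinuousPoset (L : Type u) [PartialOrder L] : Prop :=
  ∀ r : L, OrdFilter {s : L | WayAbove s r} ∧ IsGLB {s : L | WayAbove s r} r

/-- Conditional completeness: every nonempty set bounded above has a supremum. -/
def CondComplete (L : Type u) [PartialOrder L] : Prop :=
  ∀ S : Set L, S.Nonempty → BddAbove S → ∃ m : L, IsLUB S m

end OrderDefs

/-- A domain: a filtered-complete continuous poset with a least element. -/
def DomainPoset (L : Type u) [PartialOrder L] [OrderBot L] : Prop :=
  FilteredComplete L ∧ ContinuousPoset L

section TopDefs
variable {E : Type v} [TopologicalSpace E]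

/-- The saturation of a set: intersection of all open sets containing it. -/
def satur (A : Set E) : Set E := ⋂₀ {G : Set E | IsOpen G ∧ A ⊆ G}

/-- A set is saturated if it is an intersection of open sets. -/
def IsSatur (A : Set E) : Prop :=
  ∃ 𝒢 : Set (Set E), (∀ G ∈ 𝒢, IsOpen G) ∧ A = ⋂₀ 𝒢

/-- The collection 𝒬 of compact saturated subsets. -/
def CompactSat (E : Type v) [TopologicalSpace E] : Set (Set E) :=
  {A : Set E | IsCompact A ∧ IsSatur A}

/-- The Borel σ-algebra generated by open sets and compact saturated sets. -/
def BorelM (E : Type v) [TopologicalSpace E] : MeasurableSpace E :=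
  MeasurableSpace.generateFrom ({A : Set E | IsOpen A} ∪ CompactSat E)

/-- Borel subsets for the σ-algebra generated by opens and compact saturated sets. -/
def IsBorelSet (B : Set E) : Prop := @MeasurableSet E (BorelM E) B

/-- The collection 𝒦 of compact Borel subsets. -/
def CompactBorel (E : Type v) [TopologicalSpace E] : Set (Set E) :=
  {A : Set E | IsBorelSet A ∧ IsCompact A}

/-- `[x]` : the compact Borel set `↑{x} ∩ closure {x}`. -/
def ptClass (x : E) : Set E := satur {x} ∩ closure {x}

end TopDefs

section MeasDefs
variable {L : Type u} {E : Type v} [PartialOrder L] [OrderBot L] [TopologicalSpace E]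

/-- An L-valued maxitive measure on the Borel σ-algebra. -/
def Maxitive (ν : Set E → L) : Prop :=
  ν ∅ = ⊥ ∧ ∀ 𝒞 : Set (Set E), 𝒞.Finite → (∀ B ∈ 𝒞, IsBorelSet B) →
    IsLUB (ν '' 𝒞) (ν (⋃₀ 𝒞))

/-- σ-maxitivity. -/
def SigmaMaxitive (ν : Set E → L) : Prop :=
  Maxitive ν ∧ ∀ 𝒞 : Set (Set E), 𝒞.Countable → (∀ B ∈ 𝒞, IsBorelSet B) →
    IsLUB (ν '' 𝒞) (ν (⋃₀ 𝒞))

/-- Complete maxitivity. -/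
def CompletelyMaxitive (ν : Set E → L) : Prop :=
  Maxitive ν ∧ ∀ 𝒞 : Set (Set E), (∀ B ∈ 𝒞, IsBorelSet B) → IsBorelSet (⋃₀ 𝒞) →
    IsLUB (ν '' 𝒞) (ν (⋃₀ 𝒞))

/-- The set `{ν G : G open, G ⊇ B}`. -/
def outerVals (ν : Set E → L) (B : Set E) : Set L :=
  {l : L | ∃ G : Set E, IsOpen G ∧ B ⊆ G ∧ ν G = l}

/-- `νp` is the map `ν⁺ : B ↦ inf {ν G : G open, G ⊇ B}` on Borel sets. -/
def IsNuPlus (ν νp : Set E → L) : Prop :=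
  ∀ B : Set E, IsBorelSet B → IsGLB (outerVals ν B) (νp B)

/-- Outer-continuity. -/
def OuterContinuous (ν : Set E → L) : Prop :=
  ∀ B : Set E, IsBorelSet B → IsGLB (outerVals ν B) (ν B)

/-- Inner-continuity. -/
def InnerContinuous (ν : Set E → L) : Prop :=
  ∀ B : Set E, IsBorelSet B →
    IsLUB {l : L | ∃ K : Set E, IsBorelSet K ∧ IsCompact K ∧ K ⊆ B ∧ ν (satur K) = l} (ν B)

/-- Regularity: inner- and outer-continuity. -/
def RegularMeasure (ν : Set E → L) : Prop :=
  InnerContinuous ν ∧ OuterContinuous ν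

/-- Weak outer-continuity: `ν K = ν⁺ K` for every compact Borel `K`. -/
def WeaklyOuterContinuous (ν : Set E → L) : Prop :=
  ∀ K : Set E, IsBorelSet K → IsCompact K → IsGLB (outerVals ν K) (ν K)

/-- Weak inner-continuity (relative to a given `ν⁺ = νp`). -/
def WeaklyInnerContinuous (ν νp : Set E → L) : Prop :=
  ∀ G : Set E, IsOpen G →
    IsLUB {l : L | ∃ K : Set E, IsBorelSet K ∧ IsCompact K ∧ K ⊆ G ∧ νp K = l} (ν G)

/-- 𝒜-smoothness. -/
def SmoothWrt (ν : Set E → L) (𝒜 : Set (Set E)) : Prop :=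
  ∀ 𝒟 : Set (Set E), 𝒟.Nonempty → 𝒟 ⊆ 𝒜 → DirectedOn (· ⊇ ·) 𝒟 →
    IsGLB (ν '' 𝒟) (ν (⋂₀ 𝒟))

/-- Saturation of a maxitive measure: `ν K = ν (↑K)` for compact Borel `K`. -/
def SaturatedMeasure (ν : Set E → L) : Prop :=
  ∀ K : Set E, IsBorelSet K → IsCompact K → ν K = ν (satur K)

/-- Tightness: `inf {ν (E ∖ K) : K compact Borel} = 0`. -/
def TightMeasure (ν : Set E → L) : Prop :=
  IsGLB {l : L | ∃ K : Set E, IsBorelSet K ∧ IsCompact K ∧ ν Kᶜ = l} (⊥ : L)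

/-- `c` is a cardinal density of `ν`. -/
def IsCardinalDensity (ν : Set E → L) (c : E → L) : Prop :=
  ∀ B : Set E, IsBorelSet B → IsLUB (c '' B) (ν B)

/-- Upper semicontinuity of a map into the poset. -/
def UscMap (c : E → L) : Prop := ∀ t : L, IsOpen {x : E | WayAbove t (c x)}

/-- Upper compactness of a map into the poset. -/
def UpperCompactMap (c : E → L) : Prop :=
  ∀ t : L, WayAbove t (⊥ : L) → IsCompact {x : E | ¬ WayAbove t (c x)}

/-- Continuity from above along decreasing sequences of Borel sets. -/
def ContinuousFromAbove (ν : Set E → L) : Prop :=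
  ∀ B : ℕ → Set E, (∀ n, IsBorelSet (B n)) → (∀ n, B (n + 1) ⊆ B n) →
    IsGLB (Set.range fun n => ν (B n)) (ν (⋂ n, B n))

/-- An optimal measure: a σ-maxitive measure continuous from above. -/
def OptimalMeasure (ν : Set E → L) : Prop :=
  SigmaMaxitive ν ∧ ContinuousFromAbove ν

/-- `flo` is the regular part `⌊ν⌋` (relative to `νp = ν⁺`):
`⌊ν⌋(B) = sup {ν⁺(K) : K compact Borel, K ⊆ B}`. -/
def RegPartRel (νp flo : Set E → L) : Prop :=
  ∀ B : Set E, IsBorelSet B →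
    IsLUB {l : L | ∃ K : Set E, IsBorelSet K ∧ IsCompact K ∧ K ⊆ B ∧ νp K = l} (flo B)

end MeasDefs

section WayAboveLemmas
variable {L : Type u} [PartialOrder L]

theorem WayAbove.mono {t s r q : L} (h : WayAbove s r) (hst : s ≤ t) (hqr : q ≤ r) :
    WayAbove t q :=
  fun F hF i hi hiq => hF.2 s (h F hF i hi (hiq.trans hqr)) t hst

theorem WayAbove.exists_mem_le {S : Set L} (hS : DirFiltered S) {i t : L} (hi : IsGLB S i)
    (h : WayAbove t i) : ∃ s ∈ S, s ≤ t := by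
  refine h {u | ∃ s ∈ S, s ≤ u} ⟨⟨?_, ?_⟩, ?_⟩ i ⟨?_, ?_⟩ le_rfl
  · obtain ⟨s, hs⟩ := hS.1
    exact ⟨s, s, hs, le_rfl⟩
  · rintro u ⟨a, ha, hau⟩ w ⟨b, hb, hbw⟩
    obtain ⟨c, hc, hca, hcb⟩ := hS.2 a ha b hb
    exact ⟨c, ⟨c, hc, le_rfl⟩, hca.trans hau, hcb.trans hbw⟩
  · rintro u ⟨a, ha, hau⟩ w huw
    exact ⟨a, ha, hau.trans huw⟩
  · rintro u ⟨a, ha, hau⟩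
    exact (hi.1 ha).trans hau
  · intro l hl
    exact hi.2 fun s hs => hl ⟨s, hs, le_rfl⟩

theorem WayAbove.interpolate (hL : ContinuousPoset L) {t r : L} (h : WayAbove t r) :
    ∃ s, WayAbove t s ∧ WayAbove s r := by
  refine h {u | ∃ s, WayAbove u s ∧ WayAbove s r} ⟨⟨?_, ?_⟩, ?_⟩ r ⟨?_, ?_⟩ le_rfl
  · obtain ⟨s, hs⟩ := (hL r).1.1.1
    obtain ⟨u, hu⟩ := (hL s).1.1.1
    exact ⟨u, s, hu, hs⟩
  · rintro u ⟨a, hua, har⟩ w ⟨b, hwb, hbr⟩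
    obtain ⟨c, hc, hca, hcb⟩ := (hL r).1.1.2 a har b hbr
    obtain ⟨v, hv, hvu, hvw⟩ :=
      (hL c).1.1.2 u (hua.mono le_rfl hca) w (hwb.mono le_rfl hcb)
    exact ⟨v, ⟨c, hv, hc⟩, hvu, hvw⟩
  · rintro u ⟨a, hua, har⟩ w huw
    exact ⟨a, hua.mono huw le_rfl, har⟩
  · rintro u ⟨a, hua, har⟩
    exact ((hL r).2.1 har).trans ((hL a).2.1 hua)
  · intro l hl
    exact (hL r).2.2 fun s hs => (hL s).2.2 fun u hu => hl ⟨s, hu, hs⟩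

end WayAboveLemmas

section BorelLemmas
variable {E : Type v} [TopologicalSpace E]

theorem IsOpen.isBorelSet {G : Set E} (hG : IsOpen G) : IsBorelSet G :=
  MeasurableSpace.measurableSet_generateFrom (Or.inl hG)

theorem IsBorelSet.compl {B : Set E} (hB : IsBorelSet B) : IsBorelSet Bᶜ :=
  MeasurableSet.compl (m := BorelM E) hB

theorem IsClosed.isBorelSet {C : Set E} (hC : IsClosed C) : IsBorelSet C := by
  simpa using hC.isOpen_compl.isBorelSet.compl

theorem IsBorelSet.union {A B : Set E} (hA : IsBorelSet A) (hB : IsBorelSet B) :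
    IsBorelSet (A ∪ B) :=
  MeasurableSet.union (m := BorelM E) hA hB

theorem IsBorelSet.inter {A B : Set E} (hA : IsBorelSet A) (hB : IsBorelSet B) :
    IsBorelSet (A ∩ B) :=
  MeasurableSet.inter (m := BorelM E) hA hB

theorem satur_singleton_subset {x : E} {G : Set E} (hG : IsOpen G) (hx : x ∈ G) :
    satur {x} ⊆ G :=
  sInter_subset_of_mem ⟨hG, singleton_subset_iff.2 hx⟩

theorem isCompact_satur_singleton (x : E) : IsCompact (satur ({x} : Set E)) := by
  refine isCompact_of_finite_subcover fun U hU hcov => ?_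
  obtain ⟨i, hi⟩ := mem_iUnion.1 (hcov (mem_sInter.2 fun G hG => hG.2 rfl : x ∈ satur {x}))
  exact ⟨{i}, by simpa using satur_singleton_subset (hU i) hi⟩

theorem isBorelSet_ptClass (x : E) : IsBorelSet (ptClass x) :=
  IsBorelSet.inter
    (MeasurableSpace.measurableSet_generateFrom
      (Or.inr ⟨isCompact_satur_singleton x, _, fun _ hG => hG.1, rfl⟩))
    isClosed_closure.isBorelSet

theorem ptClass_subset_iff {x : E} {G : Set E} (hG : IsOpen G) : ptClass x ⊆ G ↔ x ∈ G :=
  ⟨fun h => h ⟨mem_sInter.2 fun _ hU => hU.2 rfl, subset_closure rfl⟩,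
    fun hx => inter_subset_left.trans (satur_singleton_subset hG hx)⟩

end BorelLemmas

theorem IsNuPlus.ptClass_le {L : Type u} {E : Type v} [PartialOrder L] [TopologicalSpace E]
    {ν νp : Set E → L} (hνp : IsNuPlus ν νp) {x : E} {G : Set E} (hG : IsOpen G) (hx : x ∈ G) : νp (ptClass x) ≤ ν G :=
  (hνp _ (isBorelSet_ptClass x)).1 ⟨G, hG, (ptClass_subset_iff hG).2 hx, rfl⟩

section MaxitiveLemmas
variable {L : Type u} {E : Type v} [PartialOrder L] [OrderBot L] [TopologicalSpace E]
  {ν νp : Set E → L}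

theorem Maxitive.isLUB_union (hν : Maxitive ν) {A B : Set E} (hA : IsBorelSet A)
    (hB : IsBorelSet B) : IsLUB {ν A, ν B} (ν (A ∪ B)) := by
  simpa [image_pair] using hν.2 {A, B} (toFinite _) (by simp [hA, hB])

theorem Maxitive.mono (hν : Maxitive ν) {A B : Set E} (hA : IsBorelSet A)
    (hB : IsBorelSet B) (h : A ⊆ B) : ν A ≤ ν B := by
  have := (hν.isLUB_union hA hB).1 (mem_insert _ _)
  rwa [union_eq_self_of_subset_left h] at this

theorem Maxitive.dirFiltered_outerVals (hν : Maxitive ν) (B : Set E) :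
    DirFiltered (outerVals ν B) := by
  refine ⟨⟨ν univ, univ, isOpen_univ, subset_univ _, rfl⟩, ?_⟩
  rintro _ ⟨G, hG, hBG, rfl⟩ _ ⟨H, hH, hBH, rfl⟩
  exact ⟨_, ⟨G ∩ H, hG.inter hH, subset_inter hBG hBH, rfl⟩,
    hν.mono (hG.inter hH).isBorelSet hG.isBorelSet inter_subset_left,
    hν.mono (hG.inter hH).isBorelSet hH.isBorelSet inter_subset_right⟩

theorem Maxitive.dirFiltered_compl_compact (hν : Maxitive ν) :
    DirFiltered {l : L | ∃ K : Set E, IsBorelSet K ∧ IsCompact K ∧ ν Kᶜ = l} := by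
  refine ⟨⟨_, ∅, isOpen_empty.isBorelSet, isCompact_empty, rfl⟩, ?_⟩
  rintro _ ⟨K, hK, hKc, rfl⟩ _ ⟨M, hM, hMc, rfl⟩
  exact ⟨_, ⟨K ∪ M, hK.union hM, hKc.union hMc, rfl⟩,
    hν.mono (hK.union hM).compl hK.compl (compl_subset_compl.2 subset_union_left),
    hν.mono (hK.union hM).compl hM.compl (compl_subset_compl.2 subset_union_right)⟩

theorem IsNuPlus.exists_open_le (hνp : IsNuPlus ν νp) (hν : Maxitive ν) {x : E} {t : L}
    (h : WayAbove t (νp (ptClass x))) : ∃ G, IsOpen G ∧ x ∈ G ∧ ν G ≤ t := by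
  obtain ⟨_, ⟨G, hG, hxG, rfl⟩, hle⟩ :=
    h.exists_mem_le (hν.dirFiltered_outerVals _) (hνp _ (isBorelSet_ptClass x))
  exact ⟨G, hG, (ptClass_subset_iff hG).1 hxG, hle⟩

theorem IsNuPlus.uscMap (hνp : IsNuPlus ν νp) (hν : Maxitive ν) (hL : ContinuousPoset L) :
    UscMap (fun x : E => νp (ptClass x)) := by
  intro t
  refine isOpen_iff_forall_mem_open.2 fun x hx => ?_
  obtain ⟨s, hts, hs⟩ := WayAbove.interpolate hL hx
  obtain ⟨G, hG, hxG, hle⟩ := hνp.exists_open_le hν hs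
  exact ⟨G, fun y hy => hts.mono le_rfl ((hνp.ptClass_le hG hy).trans hle), hG, hxG⟩

theorem IsNuPlus.le_of_forall_wayAbove (hνp : IsNuPlus ν νp) (hν : Maxitive ν) {K : Set E}
    (hK : IsBorelSet K) (hKc : IsCompact K) {t : L}
    (h : ∀ x ∈ K, WayAbove t (νp (ptClass x))) : νp K ≤ t := by
  obtain ⟨G, hG, hKG, hle⟩ : ∃ G, IsOpen G ∧ K ⊆ G ∧ ν G ≤ t := by
    refine hKc.induction_on (p := fun A => ∃ G, IsOpen G ∧ A ⊆ G ∧ ν G ≤ t) ?_ ?_ ?_ ?_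
    · exact ⟨∅, isOpen_empty, Subset.rfl, hν.1 ▸ bot_le⟩
    · rintro A B hAB ⟨G, hG, hBG, hle⟩
      exact ⟨G, hG, hAB.trans hBG, hle⟩
    · rintro A B ⟨G, hG, hAG, hGt⟩ ⟨H, hH, hBH, hHt⟩
      refine ⟨G ∪ H, hG.union hH, union_subset_union hAG hBH, ?_⟩
      exact (hν.isLUB_union hG.isBorelSet hH.isBorelSet).2 (by simp [hGt, hHt])
    · intro x hx
      obtain ⟨G, hG, hxG, hle⟩ := hνp.exists_open_le hν (h x hx)
      exact ⟨G, mem_nhdsWithin_of_mem_nhds (hG.mem_nhds hxG), G, hG, Subset.rfl, hle⟩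
  exact ((hνp K hK).1 ⟨G, hG, hKG, rfl⟩).trans hle

end MaxitiveLemmas

/-- if ν is tight and outer-continuous then `c⁺ : x ↦ ν⁺([x])` is
upper compact; conversely, if ν is weakly inner-continuous and `c⁺` is upper
compact then ν is tight. -/
theorem stmt12 {L : Type u} {E : Type v} [PartialOrder L] [OrderBot L]
    [TopologicalSpace E] (hL : DomainPoset L)
    (ν νp : Set E → L) (hν : Maxitive ν) (hνp : IsNuPlus ν νp) :
    (TightMeasure ν → OuterContinuous ν →
      UpperCompactMap (fun x : E => νp (ptClass x))) ∧
    (WeaklyInnerContinuous ν νp → UpperCompactMap (fun x : E => νp (ptClass x)) →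
      TightMeasure ν) := by
  have hclosed (t : L) : IsClosed {x : E | ¬ WayAbove t (νp (ptClass x))} :=
    (hνp.uscMap hν hL.2 t).isClosed_compl
  refine ⟨fun htight hout t ht => ?_, fun hin hupper => ?_⟩
  · obtain ⟨s, hts, hs⟩ := WayAbove.interpolate hL.2 ht
    obtain ⟨_, ⟨K, hK, hKc, rfl⟩, hle⟩ := hs.exists_mem_le hν.dirFiltered_compl_compact htight
    refine hKc.of_isClosed_subset (hclosed t) fun x hx => ?_
    by_contra hxK
    refine hx (hts.mono le_rfl (le_trans ((hout _ hK.compl).2 ?_) hle))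
    rintro _ ⟨G, hG, hKG, rfl⟩
    exact hνp.ptClass_le hG (hKG hxK)
  · refine ⟨fun _ _ => bot_le, fun l hl => (hL.2 ⊥).2.2 fun t ht => ?_⟩
    refine (hl ⟨_, (hclosed t).isBorelSet, hupper t ht, rfl⟩).trans ?_
    refine (hin _ (hclosed t).isOpen_compl).2 ?_
    rintro _ ⟨K, hK, hKc, hKG, rfl⟩
    exact hνp.le_of_forall_wayAbove hν hK hKc fun x hx => not_not.1 (hKG hx)
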